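/- arXiv:1307.7874 — 2 statements merged into one kernel-verified Lean document; each statement's English description precedes it below -/
import Mathlib

section
/- For every λ > 1 and α > 0, the function x ↦ x^{-2} is integrable with respect to ν(λ,α) and ∫ x^{-2} dν(λ,α)(x) = λ/(α²(λ−1)³). -/
open MeasureTheory Real

/-- The Marchenko–Pastur (free-Poisson) distribution `ν(λ, α)`:
`ν(λ,α) = max{0, 1−λ}·δ₀ + μ̃`, where `μ̃` has density
`x ↦ (1/(2παx))·√(4λα² − (x − α(1+λ))²)` with respect to Lebesgue measure on the
interval `(α(1−√λ)², α(1+√λ)²)`, and density `0` elsewhere. -/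
noncomputable def marchenkoPastur (lam alpha : ℝ) : Measure ℝ :=
  (ENNReal.ofReal (max 0 (1 - lam))) • Measure.dirac 0 +
    volume.withDensity fun x => ENNReal.ofReal
      (Set.indicator (Set.Ioo (alpha * (1 - Real.sqrt lam) ^ 2) (alpha * (1 + Real.sqrt lam) ^ 2))
        (fun x => (1 / (2 * Real.pi * alpha * x)) *
          Real.sqrt (4 * lam * alpha ^ 2 - (x - alpha * (1 + lam)) ^ 2)) x)

/-- A primitive of `v ↦ √(r² - v²)` on `(-r, r)`. -/
theorem hasDerivAt_semicircle_primitive {r v : ℝ} (hr : 0 < r) (h₁ : -r < v) (h₂ : v < r) :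
    HasDerivAt (fun v : ℝ => (v * √(r ^ 2 - v ^ 2) + r ^ 2 * arcsin (v / r)) / 2)
      (√(r ^ 2 - v ^ 2)) v := by
  have hpos : 0 < r ^ 2 - v ^ 2 := by nlinarith
  have hs : 0 < √(r ^ 2 - v ^ 2) := Real.sqrt_pos.2 hpos
  have hsq : √(r ^ 2 - v ^ 2) ^ 2 = r ^ 2 - v ^ 2 := Real.sq_sqrt hpos.le
  have hsqrt : HasDerivAt (fun v : ℝ => √(r ^ 2 - v ^ 2))
      (-(2 * v) / (2 * √(r ^ 2 - v ^ 2))) v := by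
    have := ((hasDerivAt_pow 2 v).const_sub (r ^ 2)).sqrt hpos.ne'
    simpa using this
  have harcsin : HasDerivAt (fun v : ℝ => arcsin (v / r)) (1 / √(r ^ 2 - v ^ 2)) v := by
    have hl : v / r ≠ -1 := ((lt_div_iff₀ hr).2 (by linarith)).ne'
    have hu : v / r ≠ 1 := ((div_lt_iff₀ hr).2 (by linarith)).ne
    have := (Real.hasDerivAt_arcsin hl hu).comp v ((hasDerivAt_id v).div_const r)
    refine this.congr_deriv ?_
    have hscale : √(1 - (v / r) ^ 2) = √(r ^ 2 - v ^ 2) / r := by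
      rw [show 1 - (v / r) ^ 2 = (r ^ 2 - v ^ 2) / r ^ 2 by field_simp, Real.sqrt_div hpos.le,
        Real.sqrt_sq hr.le]
    rw [hscale]
    field_simp
  refine ((((hasDerivAt_id v).mul hsqrt).add (harcsin.const_mul (r ^ 2))).div_const 2).congr_deriv ?_
  simp only [id]
  field_simp
  linear_combination -hsq

theorem continuousOn_sqrt_mul_div_cube {a b : ℝ} (ha : 0 < a) :
    ContinuousOn (fun x : ℝ => √((x - a) * (b - x)) / x ^ 3) (Set.Icc a b) :=
  ContinuousOn.div (by fun_prop) (by fun_prop) fun _ hx => (pow_pos (ha.trans_le hx.1) 3).ne'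

theorem integral_sqrt_mul_div_cube {a b : ℝ} (ha : 0 < a) (hab : a < b) :
    ∫ x in a..b, √((x - a) * (b - x)) / x ^ 3 =
      π * (b - a) ^ 2 / (8 * √(a * b) ^ 3) := by
  have hb : 0 < b := ha.trans hab
  have hs : 0 < √(a * b) := Real.sqrt_pos.2 (mul_pos ha hb)
  have hs2 : √(a * b) ^ 2 = a * b := Real.sq_sqrt (mul_pos ha hb).le
  set r : ℝ := (b - a) / (2 * (a * b)) with hr_def
  set c : ℝ := (a + b) / (2 * (a * b)) with hc_def
  have hr : 0 < r := div_pos (sub_pos.2 hab) (by positivity)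
  have hva : a⁻¹ - c = r := by rw [hr_def, hc_def]; field_simp; ring
  have hvb : b⁻¹ - c = -r := by rw [hr_def, hc_def]; field_simp; ring
  have key := intervalIntegral.integral_eq_sub_of_hasDerivAt_of_le hab.le
    (f := fun x => -√(a * b) *
      (((x⁻¹ - c) * √(r ^ 2 - (x⁻¹ - c) ^ 2) + r ^ 2 * arcsin ((x⁻¹ - c) / r)) / 2))
    (f' := fun x => √((x - a) * (b - x)) / x ^ 3) ?_ ?_
    ((continuousOn_sqrt_mul_div_cube ha).intervalIntegrable_of_Icc hab.le)
  · rw [key, hva, hvb, neg_div, div_self hr.ne']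
    simp only [arcsin_neg, arcsin_one, neg_sq, sub_self, Real.sqrt_zero]
    rw [hr_def]
    field_simp
    linear_combination 16 * π * (b - a) ^ 2 * (√(a * b) ^ 2 + a * b) * hs2
  · have hinv : ContinuousOn (fun x : ℝ => x⁻¹) (Set.Icc a b) :=
      continuousOn_id.inv₀ fun _ hx => (ha.trans_le hx.1).ne'
    have := Real.continuous_arcsin
    fun_prop
  · intro x hx
    have hx0 : 0 < x := ha.trans hx.1
    have h₁ : -r < x⁻¹ - c := by
      have := inv_strictAnti₀ hx0 hx.2
      linarith
    have h₂ : x⁻¹ - c < r := by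
      have := inv_strictAnti₀ ha hx.1
      linarith
    have hinv : HasDerivAt (fun x : ℝ => x⁻¹ - c) (-(x ^ 2)⁻¹) x :=
      (hasDerivAt_inv hx0.ne').sub_const c
    refine (((hasDerivAt_semicircle_primitive hr h₁ h₂).comp x hinv).const_mul
      (-√(a * b))).congr_deriv ?_
    have hroot : √((x - a) * (b - x)) = x * √(a * b) * √(r ^ 2 - (x⁻¹ - c) ^ 2) := by
      rw [← Real.sqrt_sq hx0.le, ← Real.sqrt_mul (sq_nonneg x), ← Real.sqrt_mul (by positivity),
        Real.sqrt_sq hx0.le]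
      congr 1
      rw [hr_def, hc_def]
      field_simp
      ring
    rw [hroot]
    field_simp

/-- For every `λ > 1` and `α > 0`, the function `x ↦ x⁻²` is integrable with respect to
`ν(λ,α)` and `∫ x⁻² dν(λ,α)(x) = λ/(α²(λ−1)³)`. -/
theorem stmt5 (lam alpha : ℝ) (hlam : 1 < lam) (halpha : 0 < alpha) :
    Integrable (fun x : ℝ => (x ^ 2)⁻¹) (marchenkoPastur lam alpha) ∧
      ∫ x, (x ^ 2)⁻¹ ∂(marchenkoPastur lam alpha) = lam / (alpha ^ 2 * (lam - 1) ^ 3) := by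
  set a := alpha * (1 - √lam) ^ 2 with ha_def
  set b := alpha * (1 + √lam) ^ 2 with hb_def
  have hlam0 : 0 < lam := by linarith
  have hsq : √lam ^ 2 = lam := Real.sq_sqrt hlam0.le
  have hs1 : 1 < √lam := Real.lt_sqrt_of_sq_lt (by simpa using hlam)
  have ha : 0 < a := mul_pos halpha (sq_pos_of_neg (by linarith))
  have hab : a < b := by rw [ha_def, hb_def]; gcongr 1; nlinarith
  set f : ℝ → ℝ := (Set.Ioo a b).indicator (fun x => (1 / (2 * π * alpha * x)) *
    √(4 * lam * alpha ^ 2 - (x - alpha * (1 + lam)) ^ 2)) with hf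
  have hf_meas : Measurable f := by
    refine Measurable.indicator ?_ measurableSet_Ioo
    fun_prop
  have hf_nonneg : ∀ x, 0 ≤ f x := Set.indicator_nonneg fun x hx => by
    have := ha.trans hx.1
    positivity
  have hmeasure : marchenkoPastur lam alpha = volume.withDensity fun x => ENNReal.ofReal (f x) := by
    simp [marchenkoPastur, max_eq_left (sub_nonpos.2 hlam.le), hf, ha_def, hb_def]
  have hprod : (fun x => (ENNReal.ofReal (f x)).toReal • (x ^ 2)⁻¹) =
      (Set.Ioo a b).indicator fun x => (2 * π * alpha)⁻¹ * (√((x - a) * (b - x)) / x ^ 3) := by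
    ext x
    rw [ENNReal.toReal_ofReal (hf_nonneg x), hf]
    by_cases hx : x ∈ Set.Ioo a b
    · have hx0 : 0 < x := ha.trans hx.1
      have hquad : 4 * lam * alpha ^ 2 - (x - alpha * (1 + lam)) ^ 2 = (x - a) * (b - x) := by
        rw [ha_def, hb_def, ← hsq, Real.sqrt_sq (Real.sqrt_nonneg lam)]
        ring
      simp only [Set.indicator_of_mem hx, hquad, smul_eq_mul]
      field_simp
    · simp [Set.indicator_of_notMem hx]
  have hdens : Measurable fun x => ENNReal.ofReal (f x) := hf_meas.ennreal_ofReal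
  have hfin : ∀ᵐ x, ENNReal.ofReal (f x) < ⊤ := by simp
  rw [hmeasure]
  constructor
  · rw [integrable_withDensity_iff_integrable_smul' hdens hfin, hprod,
      integrable_indicator_iff measurableSet_Ioo]
    exact (((continuousOn_sqrt_mul_div_cube ha).integrableOn_Icc).mono_set
      Set.Ioo_subset_Icc_self).const_mul _
  · have hsqrt : √(a * b) = alpha * (lam - 1) := by
      rw [← Real.sqrt_sq (mul_pos halpha (sub_pos.2 hlam)).le]
      congr 1
      rw [ha_def, hb_def]
      linear_combination alpha ^ 2 * (√lam ^ 2 + lam - 2) * hsq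
    have hdiff : (b - a) ^ 2 = 16 * alpha ^ 2 * lam := by
      rw [ha_def, hb_def]
      linear_combination 16 * alpha ^ 2 * hsq
    have hlam1 : lam - 1 ≠ 0 := (sub_pos.2 hlam).ne'
    rw [integral_withDensity_eq_integral_toReal_smul hdens hfin, hprod,
      integral_indicator measurableSet_Ioo, ← integral_Ioc_eq_integral_Ioo,
      ← intervalIntegral.integral_of_le hab.le, intervalIntegral.integral_const_mul,
      integral_sqrt_mul_div_cube ha hab, hsqrt, hdiff]
    field_simp
    norm_num
end

section
/- For every σ > 0 and θ > 1, the free-binomial distribution β(σ,θ) is a probability measure on ℝ, i.e. β(σ,θ)(ℝ) = 1. -/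
open MeasureTheory Real

/-- Left endpoint `x₋` of the support of the absolutely continuous part of the
free-binomial distribution `β(σ,θ)`. -/
noncomputable def xMinus (s t : ℝ) : ℝ :=
  (Real.sqrt ((s / (s + t)) * (1 - 1 / (s + t))) -
    Real.sqrt ((1 / (s + t)) * (1 - s / (s + t)))) ^ 2

/-- Right endpoint `x₊` of the support of the absolutely continuous part of the
free-binomial distribution `β(σ,θ)`. -/
noncomputable def xPlus (s t : ℝ) : ℝ :=
  (Real.sqrt ((s / (s + t)) * (1 - 1 / (s + t))) +
    Real.sqrt ((1 / (s + t)) * (1 - s / (s + t)))) ^ 2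

/-- The free-binomial distribution `β(σ,θ)` (for `θ > 1`, so no atom at `1`):
`β(σ,θ) = (1−σ)·𝟙_{0<σ<1}·δ₀ + β̃`, where `β̃` has density
`x ↦ (σ+θ)·√((x−x₋)(x₊−x))/(2πx(1−x))` with respect to Lebesgue measure on the
interval `(x₋, x₊)`, and density `0` elsewhere. -/
noncomputable def freeBinomial (s t : ℝ) : Measure ℝ :=
  (ENNReal.ofReal ((1 - s) * (if 0 < s ∧ s < 1 then 1 else 0))) • Measure.dirac 0 +
    volume.withDensity fun x => ENNReal.ofReal
      (Set.indicator (Set.Ioo (xMinus s t) (xPlus s t))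
        (fun x => (s + t) * Real.sqrt ((x - xMinus s t) * (xPlus s t - x)) /
          (2 * Real.pi * x * (1 - x))) x)

/-- Chain rule for `arcsin ∘ u` when `√(1 - u²)` is known explicitly. -/
theorem hasDerivAt_arcsin_comp {u : ℝ → ℝ} {u' w x : ℝ} (hu : HasDerivAt u u' x)
    (hw : 0 < w) (h : 1 - u x ^ 2 = w ^ 2) :
    HasDerivAt (fun y => arcsin (u y)) (u' / w) x := by
  have hw2 : 0 < w ^ 2 := by positivity
  have h1 : u x ≠ -1 := fun e => by rw [e] at h; linarith
  have h2 : u x ≠ 1 := fun e => by rw [e] at h; linarith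
  have := (Real.hasDerivAt_arcsin h1 h2).comp x hu
  rw [h, Real.sqrt_sq hw.le] at this
  exact this.congr_deriv (by ring)

/-- An antiderivative of `√((x - a)(b - x)) / x`. -/
noncomputable def semicirclePrimitive (a b x : ℝ) : ℝ :=
  √((x - a) * (b - x)) + (a + b) / 2 * arcsin ((2 * x - a - b) / (b - a)) -
    √(a * b) * arcsin (((a + b) * x - 2 * a * b) / (x * (b - a)))

theorem continuousOn_semicirclePrimitive {a b : ℝ} (ha : 0 ≤ a) (hab : a < b) :
    ContinuousOn (semicirclePrimitive a b) (Set.Icc a b) := by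
  unfold semicirclePrimitive
  refine ContinuousOn.sub (by fun_prop) ?_
  rcases ha.eq_or_lt with rfl | ha
  · simpa using continuousOn_const
  · refine continuousOn_const.mul (Real.continuous_arcsin.comp_continuousOn ?_)
    refine ContinuousOn.div (by fun_prop) (by fun_prop) fun x hx => ?_
    exact mul_ne_zero (ha.trans_le hx.1).ne' (sub_pos.2 hab).ne'

theorem hasDerivAt_semicirclePrimitive {a b x : ℝ} (ha : 0 ≤ a) (hx : x ∈ Set.Ioo a b) :
    HasDerivAt (semicirclePrimitive a b) (√((x - a) * (b - x)) / x) x := by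
  have hxa : 0 < x - a := sub_pos.2 hx.1
  have hbx : 0 < b - x := sub_pos.2 hx.2
  have hx0 : 0 < x := ha.trans_lt hx.1
  have hba : 0 < b - a := by linarith
  have hq : 0 < (x - a) * (b - x) := mul_pos hxa hbx
  obtain ⟨R, hRdef⟩ : ∃ R, R = √((x - a) * (b - x)) := ⟨_, rfl⟩
  have hR : 0 < R := hRdef ▸ Real.sqrt_pos.2 hq
  have hR2 : R ^ 2 = (x - a) * (b - x) := hRdef ▸ Real.sq_sqrt hq.le
  have d1 : HasDerivAt (fun y => √((y - a) * (b - y))) ((a + b - 2 * x) / (2 * R)) x := by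
    rw [hRdef]
    refine HasDerivAt.sqrt ?_ hq.ne'
    exact (((hasDerivAt_id' x).sub_const a).mul ((hasDerivAt_id' x).const_sub b)).congr_deriv
      (by ring)
  have d2 : HasDerivAt (fun y => arcsin ((2 * y - a - b) / (b - a)))
      (2 / (b - a) / (2 * R / (b - a))) x := by
    refine hasDerivAt_arcsin_comp ?_ (by positivity) ?_
    · exact (((((hasDerivAt_id' x).const_mul 2).sub_const a).sub_const b).div_const
        (b - a)).congr_deriv (by ring)
    · field_simp
      rw [hR2]
      ring
  have d3 : HasDerivAt
      (fun y => √(a * b) * arcsin (((a + b) * y - 2 * a * b) / (y * (b - a))))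
      (a * b / (x * R)) x := by
    rcases ha.eq_or_lt with rfl | ha
    · simpa using hasDerivAt_const x (0 : ℝ)
    · have hp : 0 < a * b := mul_pos ha (by linarith)
      obtain ⟨S, hSdef⟩ : ∃ S, S = √(a * b) := ⟨_, rfl⟩
      have hS : 0 < S := hSdef ▸ Real.sqrt_pos.2 hp
      have hS2 : S ^ 2 = a * b := hSdef ▸ Real.sq_sqrt hp.le
      rw [← hSdef]
      have du : HasDerivAt (fun y => ((a + b) * y - 2 * a * b) / (y * (b - a)))
          (2 * S ^ 2 / (x ^ 2 * (b - a))) x := by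
        refine ((((hasDerivAt_id' x).const_mul (a + b)).sub_const (2 * a * b)).div
          ((hasDerivAt_id' x).mul_const (b - a)) (by positivity)).congr_deriv ?_
        rw [hS2]
        field_simp
        ring
      refine ((hasDerivAt_arcsin_comp du (w := 2 * S * R / (x * (b - a)))
        (by positivity) ?_).const_mul S).congr_deriv ?_
      · rw [div_pow, div_pow, mul_pow, mul_pow, mul_pow, hR2, hS2]
        field_simp
        ring
      · rw [← hS2]
        field_simp
  rw [← hRdef]
  refine ((d1.add (d2.const_mul ((a + b) / 2))).sub d3).congr_deriv ?_
  field_simp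
  rw [hR2]
  ring

theorem intervalIntegrable_semicircle_div {a b : ℝ} (ha : 0 ≤ a) (hab : a < b) :
    IntervalIntegrable (fun x => √((x - a) * (b - x)) / x) volume a b := by
  rw [intervalIntegrable_iff_integrableOn_Ioc_of_le hab.le]
  exact intervalIntegral.integrableOn_deriv_of_nonneg (continuousOn_semicirclePrimitive ha hab)
    (fun x hx => hasDerivAt_semicirclePrimitive ha hx)
    (fun x hx => div_nonneg (Real.sqrt_nonneg _) (ha.trans hx.1.le))

theorem integral_semicircle_div {a b : ℝ} (ha : 0 ≤ a) (hab : a < b) :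
    ∫ x in a..b, √((x - a) * (b - x)) / x = π * ((a + b) / 2 - √(a * b)) := by
  rw [intervalIntegral.integral_eq_sub_of_hasDerivAt_of_le hab.le
    (continuousOn_semicirclePrimitive ha hab)
    (fun x hx => hasDerivAt_semicirclePrimitive ha hx)
    (intervalIntegrable_semicircle_div ha hab)]
  have hba : b - a ≠ 0 := (sub_pos.2 hab).ne'
  have hb : b ≠ 0 := (ha.trans_lt hab).ne'
  have e1 : (2 * b - a - b) / (b - a) = 1 := by field_simp; ring
  have e2 : (2 * a - a - b) / (b - a) = -1 := by field_simp; ring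
  have e3 : ((a + b) * b - 2 * a * b) / (b * (b - a)) = 1 := by field_simp; ring
  have e4 : √(a * b) * arcsin (((a + b) * a - 2 * a * b) / (a * (b - a))) =
      √(a * b) * -(π / 2) := by
    rcases ha.eq_or_lt with rfl | ha
    · simp
    · rw [show ((a + b) * a - 2 * a * b) / (a * (b - a)) = -1 by field_simp; ring,
        Real.arcsin_neg_one]
  simp only [semicirclePrimitive, e1, e2, e3, e4, Real.arcsin_one, Real.arcsin_neg_one, sub_self,
    mul_zero, zero_mul, Real.sqrt_zero]
  ring

theorem sqrt_reflect (a b x : ℝ) :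
    √((1 - x - (1 - b)) * (1 - a - (1 - x))) / (1 - x) = √((x - a) * (b - x)) / (1 - x) := by
  congr 2
  ring

theorem intervalIntegrable_semicircle_div_one_sub {a b : ℝ} (hb : b ≤ 1) (hab : a < b) :
    IntervalIntegrable (fun x => √((x - a) * (b - x)) / (1 - x)) volume a b := by
  have h := (intervalIntegrable_semicircle_div (a := 1 - b) (b := 1 - a) (by linarith)
    (by linarith)).comp_sub_left 1
  simp only [sqrt_reflect, sub_sub_cancel] at h
  exact h.symm

theorem integral_semicircle_div_one_sub {a b : ℝ} (hb : b ≤ 1) (hab : a < b) :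
    ∫ x in a..b, √((x - a) * (b - x)) / (1 - x) =
      π * (1 - (a + b) / 2 - √((1 - a) * (1 - b))) := by
  have h := intervalIntegral.integral_comp_sub_left (a := a) (b := b)
    (fun y => √((y - (1 - b)) * (1 - a - y)) / y) 1
  simp only [sqrt_reflect] at h
  rw [h, integral_semicircle_div (by linarith) (by linarith), mul_comm (1 - b)]
  ring

theorem div_mul_one_sub_eq_add {a b x : ℝ} (hb : b ≤ 1) (ha : 0 ≤ a) (hx : x ∈ Set.Ioo a b)
    (c : ℝ) : c / (2 * π) * (√((x - a) * (b - x)) / x + √((x - a) * (b - x)) / (1 - x)) =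
      c * √((x - a) * (b - x)) / (2 * π * x * (1 - x)) := by
  have h0 : x ≠ 0 := (ha.trans_lt hx.1).ne'
  have h1 : 1 - x ≠ 0 := (sub_pos.2 (hx.2.trans_le hb)).ne'
  have := Real.pi_ne_zero
  field_simp
  ring

theorem lintegral_indicator_semicircle {a b c : ℝ} (ha : 0 ≤ a) (hab : a < b) (hb : b ≤ 1)
    (hc : 0 ≤ c) :
    ∫⁻ x, ENNReal.ofReal (Set.indicator (Set.Ioo a b)
        (fun x => c * √((x - a) * (b - x)) / (2 * π * x * (1 - x))) x) =
      ENNReal.ofReal (c / 2 * (1 - √(a * b) - √((1 - a) * (1 - b)))) := by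
  have hi := ((intervalIntegrable_semicircle_div ha hab).add
    (intervalIntegrable_semicircle_div_one_sub hb hab)).const_mul (c / (2 * π))
  rw [intervalIntegrable_iff_integrableOn_Ioo_of_le hab.le] at hi
  have heq : Set.EqOn _ _ (Set.Ioo a b) := fun x hx => div_mul_one_sub_eq_add hb ha hx c
  have hi' := hi.congr_fun heq measurableSet_Ioo
  rw [← ofReal_integral_eq_lintegral_ofReal (hi'.integrable_indicator measurableSet_Ioo),
    integral_indicator measurableSet_Ioo, ← setIntegral_congr_fun measurableSet_Ioo heq,
    ← integral_Ioc_eq_integral_Ioo, ← intervalIntegral.integral_of_le hab.le,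
    intervalIntegral.integral_const_mul,
    intervalIntegral.integral_add (intervalIntegrable_semicircle_div ha hab)
      (intervalIntegrable_semicircle_div_one_sub hb hab),
    integral_semicircle_div ha hab, integral_semicircle_div_one_sub hb hab]
  · congr 1
    have := Real.pi_ne_zero
    field_simp
    ring
  · refine Filter.Eventually.of_forall fun x => Set.indicator_nonneg (fun y hy => ?_) x
    have h0 : 0 < y := ha.trans_lt hy.1
    have h1 : 0 < 1 - y := sub_pos.2 (hy.2.trans_le hb)
    positivity

theorem xMinus_nonneg (s t : ℝ) : 0 ≤ xMinus s t := sq_nonneg _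

theorem xMinus_radicands_pos {s t : ℝ} (hs : 0 < s) (ht : 1 < t) :
    0 < s / (s + t) * (1 - 1 / (s + t)) ∧ 0 < 1 / (s + t) * (1 - s / (s + t)) := by
  have hn : 0 < s + t := by linarith
  exact ⟨mul_pos (by positivity) (sub_pos.2 ((div_lt_one hn).2 (by linarith))),
    mul_pos (by positivity) (sub_pos.2 ((div_lt_one hn).2 (by linarith)))⟩

theorem xMinus_lt_xPlus {s t : ℝ} (hs : 0 < s) (ht : 1 < t) : xMinus s t < xPlus s t := by
  obtain ⟨h1, h2⟩ := xMinus_radicands_pos hs ht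
  unfold xMinus xPlus
  nlinarith [mul_pos (Real.sqrt_pos.2 h1) (Real.sqrt_pos.2 h2)]

theorem xMinus_mul_xPlus {s t : ℝ} (hs : 0 < s) (ht : 1 < t) :
    xMinus s t * xPlus s t = ((s - 1) / (s + t)) ^ 2 := by
  have hn : 0 < s + t := by linarith
  obtain ⟨h1, h2⟩ := xMinus_radicands_pos hs ht
  calc xMinus s t * xPlus s t
      = (√(s / (s + t) * (1 - 1 / (s + t))) ^ 2 -
          √(1 / (s + t) * (1 - s / (s + t))) ^ 2) ^ 2 := by
        unfold xMinus xPlus; ring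
    _ = ((s - 1) / (s + t)) ^ 2 := by
        rw [Real.sq_sqrt h1.le, Real.sq_sqrt h2.le]; field_simp; ring

theorem xMinus_add_xPlus {s t : ℝ} (hs : 0 < s) (ht : 1 < t) :
    xMinus s t + xPlus s t = 2 * (s * (s + t - 1) + t) / (s + t) ^ 2 := by
  have hn : 0 < s + t := by linarith
  obtain ⟨h1, h2⟩ := xMinus_radicands_pos hs ht
  calc xMinus s t + xPlus s t
      = 2 * (√(s / (s + t) * (1 - 1 / (s + t))) ^ 2 +
          √(1 / (s + t) * (1 - s / (s + t))) ^ 2) := by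
        unfold xMinus xPlus; ring
    _ = 2 * (s * (s + t - 1) + t) / (s + t) ^ 2 := by
        rw [Real.sq_sqrt h1.le, Real.sq_sqrt h2.le]; field_simp; ring

theorem one_sub_xMinus_mul_one_sub_xPlus {s t : ℝ} (hs : 0 < s) (ht : 1 < t) :
    (1 - xMinus s t) * (1 - xPlus s t) = ((t - 1) / (s + t)) ^ 2 := by
  have hn : 0 < s + t := by linarith
  rw [show (1 - xMinus s t) * (1 - xPlus s t) =
    1 - (xMinus s t + xPlus s t) + xMinus s t * xPlus s t by ring,
    xMinus_mul_xPlus hs ht, xMinus_add_xPlus hs ht]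
  field_simp
  ring

theorem xPlus_le_one {s t : ℝ} (hs : 0 < s) (ht : 1 < t) : xPlus s t ≤ 1 := by
  have hn : 0 < s + t := by linarith
  have hsum : xMinus s t + xPlus s t < 2 := by
    rw [xMinus_add_xPlus hs ht, div_lt_iff₀ (by positivity)]
    nlinarith [mul_pos hs (by linarith : 0 < t)]
  have hprod := one_sub_xMinus_mul_one_sub_xPlus hs ht
  have hlt := xMinus_lt_xPlus hs ht
  by_contra! hc
  nlinarith [sq_nonneg ((t - 1) / (s + t))]

/-- For every `σ > 0` and `θ > 1`, the free-binomial distribution `β(σ,θ)` is a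
probability measure on `ℝ`. -/
theorem stmt6 (s t : ℝ) (hs : 0 < s) (ht : 1 < t) :
    freeBinomial s t Set.univ = 1 := by
  have hn : 0 < s + t := by linarith
  rw [freeBinomial, Measure.add_apply, Measure.smul_apply, withDensity_apply _ MeasurableSet.univ,
    Measure.restrict_univ, lintegral_indicator_semicircle (xMinus_nonneg s t)
      (xMinus_lt_xPlus hs ht) (xPlus_le_one hs ht) hn.le, xMinus_mul_xPlus hs ht,
    one_sub_xMinus_mul_one_sub_xPlus hs ht, Real.sqrt_sq_eq_abs,
    Real.sqrt_sq (div_nonneg (by linarith) hn.le), measure_univ, smul_eq_mul, mul_one, abs_div,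
    abs_of_pos hn]
  rcases lt_or_ge s 1 with h | h
  · have e : (s + t) / 2 * (1 - |s - 1| / (s + t) - (t - 1) / (s + t)) = s := by
      rw [abs_of_neg (by linarith)]
      field_simp
      ring
    rw [if_pos ⟨hs, h⟩, e, ← ENNReal.ofReal_add (by linarith) hs.le]
    simp
  · have e : (s + t) / 2 * (1 - |s - 1| / (s + t) - (t - 1) / (s + t)) = 1 := by
      rw [abs_of_nonneg (by linarith)]
      field_simp
      ring
    rw [if_neg (by simp [h]), e]
    simp
end
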